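/- (Gagliardo–Nirenberg with uniform local control) Let n ≥ 3 and Ω ⊆ ℝⁿ open. For v ∈ H¹₀(Ω), ‖v‖_{L^{2+4/n}(Ω)}^{2+4/n} ≲ ‖v‖_{H¹(Ω)}² · sup_{x ∈ ℝⁿ} ‖v‖_{L²(Q₁(x) ∩ Ω)}^{4/n}, where Q₁(x) is the unit cube centered at x. -/

import Mathlib

open MeasureTheory ENNReal

/-- The unit cube centered at `x` in `ℝⁿ`. -/
def unitCube {n : ℕ} (x : EuclideanSpace ℝ (Fin n)) : Set (EuclideanSpace ℝ (Fin n)) :=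
  {y | ∀ i, |y i - x i| ≤ 1 / 2}

/-- The global Gagliardo–Nirenberg inequality for compactly supported `C¹` functions on `ℝⁿ`. -/
theorem exists_lintegral_rpow_le_lintegral_fderiv_mul {n : ℕ} (hn : 3 ≤ n) :
    ∃ K : NNReal, ∀ u : EuclideanSpace ℝ (Fin n) → ℂ, ContDiff ℝ 1 u → HasCompactSupport u →
      ∫⁻ y, ‖u y‖ₑ ^ ((2 : ℝ) + 4 / n)
        ≤ K * (∫⁻ y, ‖fderiv ℝ u y‖ₑ ^ 2) * (∫⁻ y, ‖u y‖ₑ ^ 2) ^ ((2 : ℝ) / n) := by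
  have hn' : (3 : ℝ) ≤ n := by exact_mod_cast hn
  have hn0 : (0 : ℝ) < n := by linarith
  have hn2 : (0 : ℝ) < n - 2 := by linarith
  let q : NNReal := ⟨2 * n / (n - 2), by positivity⟩
  have hq : (q : ℝ) = 2 * n / (n - 2) := rfl
  have hq0 : q ≠ 0 := by
    rw [← NNReal.coe_ne_zero, hq]; positivity
  set c := SNormLESNormFDerivOfEqConst ℂ (volume : Measure (EuclideanSpace ℝ (Fin n))) (2 : NNReal)
  refine ⟨c ^ 2, fun u hu hcu => ?_⟩
  have sobolev : eLpNorm u q volume ≤ c * eLpNorm (fderiv ℝ u) (2 : NNReal) volume := by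
    apply eLpNorm_le_eLpNorm_fderiv_of_eq volume hu hcu (by norm_num)
    · rw [finrank_euclideanSpace_fin]; omega
    · rw [finrank_euclideanSpace_fin, hq]
      push_cast
      field_simp
  have hmeas : Measurable fun y => ‖u y‖ₑ := hu.continuous.enorm.measurable
  have holder := lintegral_mul_norm_pow_le (μ := volume)
    (f := fun y => ‖u y‖ₑ ^ (q : ℝ)) (g := fun y => ‖u y‖ₑ ^ 2)
    (hmeas.pow_const _).aemeasurable (hmeas.pow_const _).aemeasurable
    (p := (n - 2) / n) (q := 2 / n) (by positivity) (by positivity) (by field_simp; ring)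
  have hlhs : ∀ y, (‖u y‖ₑ ^ (q : ℝ)) ^ (((n : ℝ) - 2) / n) * (‖u y‖ₑ ^ 2) ^ ((2 : ℝ) / n)
      = ‖u y‖ₑ ^ ((2 : ℝ) + 4 / n) := fun y => by
    rw [← ENNReal.rpow_natCast, ← ENNReal.rpow_mul, ← ENNReal.rpow_mul,
      ← ENNReal.rpow_add_of_nonneg _ _ (by rw [hq]; positivity) (by positivity), hq]
    congr 1
    push_cast
    field_simp
    ring
  simp only [hlhs] at holder
  refine holder.trans (mul_le_mul_left ?_ _)
  have hsq : eLpNorm (fderiv ℝ u) (2 : NNReal) volume ^ 2 = ∫⁻ y, ‖fderiv ℝ u y‖ₑ ^ 2 := by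
    have := eLpNorm_nnreal_pow_eq_lintegral (f := fderiv ℝ u) (p := 2)
      (μ := (volume : Measure (EuclideanSpace ℝ (Fin n)))) two_ne_zero
    rw [NNReal.coe_ofNat, ENNReal.rpow_ofNat] at this
    simpa only [ENNReal.rpow_ofNat] using this
  calc (∫⁻ y, ‖u y‖ₑ ^ (q : ℝ)) ^ (((n : ℝ) - 2) / n)
      = eLpNorm u q volume ^ 2 := by
        rw [← eLpNorm_nnreal_pow_eq_lintegral hq0, ← ENNReal.rpow_mul, ← ENNReal.rpow_natCast, hq]
        congr 1
        push_cast
        field_simp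
    _ ≤ (c * eLpNorm (fderiv ℝ u) (2 : NNReal) volume) ^ 2 := by gcongr
    _ = _ := by rw [mul_pow, hsq]; push_cast; rfl

/-- Averaging a function against all translates of another one factors the integral. -/
theorem lintegral_lintegral_sub_mul {G : Type*} [MeasurableSpace G] [AddCommGroup G]
    [MeasurableAdd₂ G] [MeasurableNeg G] [MeasurableSub₂ G] (μ : Measure G) [SFinite μ]
    [μ.IsAddLeftInvariant] [μ.IsNegInvariant] {f g : G → ℝ≥0∞} (hf : Measurable f)
    (hg : Measurable g) :
    ∫⁻ x, ∫⁻ y, f (y - x) * g y ∂μ ∂μ = (∫⁻ x, f x ∂μ) * ∫⁻ y, g y ∂μ := by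
  rw [lintegral_lintegral_swap (by fun_prop)]
  have h : ∀ y, ∫⁻ x, f (y - x) * g y ∂μ = (∫⁻ x, f x ∂μ) * g y := fun y => by
    rw [lintegral_mul_const _ (by fun_prop), lintegral_sub_left_eq_self]
  simp only [h]
  rw [lintegral_const_mul _ hg]

/-- A pointwise product rule bound for the derivative of a translated cutoff times a function. -/
theorem enorm_fderiv_cutoff_smul_sq_le {E F : Type*} [NormedAddCommGroup E] [NormedSpace ℝ E]
    [NormedAddCommGroup F] [NormedSpace ℝ F] {χ : E → ℝ} {v : E → F} (hχ : Differentiable ℝ χ)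
    (hv : Differentiable ℝ v) (x y : E) :
    ‖fderiv ℝ (fun z => χ (z - x) • v z) y‖ₑ ^ 2
      ≤ 2 * (‖χ (y - x)‖ₑ ^ 2 * ‖fderiv ℝ v y‖ₑ ^ 2 + ‖fderiv ℝ χ (y - x)‖ₑ ^ 2 * ‖v y‖ₑ ^ 2) := by
  have hd : DifferentiableAt ℝ (fun z => χ (z - x)) y := by fun_prop
  have hnorm : ‖fderiv ℝ (fun z => χ (z - x) • v z) y‖ₑ
      ≤ ‖χ (y - x)‖ₑ * ‖fderiv ℝ v y‖ₑ + ‖fderiv ℝ χ (y - x)‖ₑ * ‖v y‖ₑ := by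
    rw [fderiv_fun_smul hd (hv y), fderiv_comp_sub]
    refine (enorm_add_le (_ : E →L[ℝ] F) _).trans ?_
    rw [enorm_smul]
    gcongr
    rw [← ofReal_norm, ← ofReal_norm, ← ofReal_norm,
      ← ENNReal.ofReal_mul (norm_nonneg _)]
    exact ENNReal.ofReal_le_ofReal (ContinuousLinearMap.norm_smulRight_apply _ _).le
  calc _ ≤ (‖χ (y - x)‖ₑ * ‖fderiv ℝ v y‖ₑ + ‖fderiv ℝ χ (y - x)‖ₑ * ‖v y‖ₑ) ^ 2 := by gcongr
    _ ≤ _ := by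
      have := ENNReal.rpow_add_le_mul_rpow_add_rpow (‖χ (y - x)‖ₑ * ‖fderiv ℝ v y‖ₑ)
        (‖fderiv ℝ χ (y - x)‖ₑ * ‖v y‖ₑ) one_le_two
      rw [← mul_pow, ← mul_pow]
      norm_num at this
      exact this

/-- A continuous compactly supported function has finite `p`-th moment. -/
theorem lintegral_rpow_enorm_ne_top {E F : Type*} [TopologicalSpace E] [MeasurableSpace E]
    [OpensMeasurableSpace E] [NormedAddCommGroup F] {μ : Measure E} [IsFiniteMeasureOnCompacts μ]
    {f : E → F} (hf : Continuous f) (hcf : HasCompactSupport f) {p : ℝ} (hp : 0 < p) :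
    ∫⁻ y, ‖f y‖ₑ ^ p ∂μ ≠ ⊤ := by
  have hmem : MemLp f (ENNReal.ofReal p) μ := hf.memLp_of_hasCompactSupport hcf
  have := lintegral_rpow_enorm_lt_top_of_eLpNorm_lt_top (by simpa using hp) ofReal_ne_top hmem.2
  rw [ENNReal.toReal_ofReal hp.le] at this
  exact this.ne

/-- The `C¹` cutoffs used to localize to unit cubes. -/
theorem exists_contDiff_cutoff_unitCube (n : ℕ) :
    ∃ χ : EuclideanSpace ℝ (Fin n) → ℝ, ContDiff ℝ 1 χ ∧ HasCompactSupport χ ∧ χ ≠ 0 ∧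
      (∀ y, ‖χ y‖ₑ ≤ 1) ∧ ∀ x y, y ∉ unitCube x → χ (y - x) = 0 := by
  let χ : ContDiffBump (0 : EuclideanSpace ℝ (Fin n)) := ⟨1 / 4, 1 / 2, by norm_num, by norm_num⟩
  refine ⟨χ, χ.contDiff, χ.hasCompactSupport, fun h => ?_, fun y => ?_, fun x y hy => ?_⟩
  · have := χ.pos_of_mem_ball (Metric.mem_ball_self χ.rOut_pos)
    simp [h] at this
  · rw [Real.enorm_of_nonneg χ.nonneg]
    exact ENNReal.ofReal_le_one.2 χ.le_one
  · refine χ.zero_of_le_dist ?_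
    by_contra! h
    rw [dist_zero_right] at h
    refine hy fun i => ?_
    have hi : ‖(y - x) i‖ ≤ ‖y - x‖ := PiLp.norm_apply_le (y - x) i
    rw [PiLp.sub_apply, Real.norm_eq_abs] at hi
    exact hi.trans h.le

/-- The localized Gagliardo–Nirenberg inequality for one translate of a cutoff. -/
theorem lintegral_cutoff_rpow_le {n : ℕ} {p r : ℝ} (hp : 0 ≤ p) (hr : 0 ≤ r) {K : NNReal}
    (hK : ∀ u : EuclideanSpace ℝ (Fin n) → ℂ, ContDiff ℝ 1 u → HasCompactSupport u →
      ∫⁻ y, ‖u y‖ₑ ^ p ≤ K * (∫⁻ y, ‖fderiv ℝ u y‖ₑ ^ 2) * (∫⁻ y, ‖u y‖ₑ ^ 2) ^ r)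
    {χ : EuclideanSpace ℝ (Fin n) → ℝ} (hχ : ContDiff ℝ 1 χ)
    {v : EuclideanSpace ℝ (Fin n) → ℂ} (hv : ContDiff ℝ 1 v) (hcv : HasCompactSupport v)
    {S : ℝ≥0∞} (x : EuclideanSpace ℝ (Fin n)) (hS : ∫⁻ y, ‖χ (y - x) • v y‖ₑ ^ 2 ≤ S) :
    ∫⁻ y, ‖χ (y - x)‖ₑ ^ p * ‖v y‖ₑ ^ p ≤ K * S ^ r *
      (2 * ∫⁻ y, (‖χ (y - x)‖ₑ ^ 2 * ‖fderiv ℝ v y‖ₑ ^ 2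
        + ‖fderiv ℝ χ (y - x)‖ₑ ^ 2 * ‖v y‖ₑ ^ 2)) := by
  have hu := hK (fun y => χ (y - x) • v y) (by fun_prop)
    (hcv.mono fun y hy hvy => hy (by simp [hvy]))
  rw [← lintegral_const_mul' _ _ ofNat_ne_top]
  calc ∫⁻ y, ‖χ (y - x)‖ₑ ^ p * ‖v y‖ₑ ^ p
      = ∫⁻ y, ‖χ (y - x) • v y‖ₑ ^ p := by
        simp only [enorm_smul, ENNReal.mul_rpow_of_nonneg _ _ hp]
    _ ≤ _ := hu
    _ ≤ K * (∫⁻ y, 2 * (‖χ (y - x)‖ₑ ^ 2 * ‖fderiv ℝ v y‖ₑ ^ 2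
          + ‖fderiv ℝ χ (y - x)‖ₑ ^ 2 * ‖v y‖ₑ ^ 2)) * S ^ r := by
        gcongr with y
        exact enorm_fderiv_cutoff_smul_sq_le (hχ.differentiable one_ne_zero)
          (hv.differentiable one_ne_zero) x y
    _ = _ := by ring

/-- Gagliardo–Nirenberg with the mass controlled uniformly over all translates of a cutoff. -/
theorem exists_lintegral_rpow_le_of_cutoff_mass_le {n : ℕ} (hn : 3 ≤ n)
    {χ : EuclideanSpace ℝ (Fin n) → ℝ} (hχ : ContDiff ℝ 1 χ) (hcχ : HasCompactSupport χ)
    (hχ0 : χ ≠ 0) :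
    ∃ D : NNReal, ∀ v : EuclideanSpace ℝ (Fin n) → ℂ, ContDiff ℝ 1 v → HasCompactSupport v →
      ∀ S : ℝ≥0∞, (∀ x, ∫⁻ y, ‖χ (y - x) • v y‖ₑ ^ 2 ≤ S) →
        ∫⁻ y, ‖v y‖ₑ ^ ((2 : ℝ) + 4 / n)
          ≤ D * ((∫⁻ y, ‖v y‖ₑ ^ 2) + ∫⁻ y, ‖fderiv ℝ v y‖ₑ ^ 2) * S ^ ((2 : ℝ) / n) := by
  obtain ⟨K, hK⟩ := exists_lintegral_rpow_le_lintegral_fderiv_mul hn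
  have hp : (0 : ℝ) < 2 + 4 / n := by positivity
  have hr : (0 : ℝ) ≤ 2 / n := by positivity
  generalize (2 : ℝ) + 4 / n = p at *
  generalize (2 : ℝ) / n = r at *
  have hχc : Continuous χ := hχ.continuous
  have hχ' : Continuous (fderiv ℝ χ) := hχ.continuous_fderiv one_ne_zero
  set A := ∫⁻ y, ‖χ y‖ₑ ^ p
  set B₁ := ∫⁻ y, ‖χ y‖ₑ ^ 2
  set B₂ := ∫⁻ y, ‖fderiv ℝ χ y‖ₑ ^ 2
  have hA0 : A ≠ 0 := by
    refine ((lintegral_pos_iff_support (by fun_prop)).2 ?_).ne'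
    have : Function.support (fun y => ‖χ y‖ₑ ^ p) = Function.support χ := by
      ext y
      simp [hp, hp.not_gt]
    rw [this]
    exact hχc.isOpen_support.measure_pos volume (Function.support_nonempty_iff.2 hχ0)
  have hAtop : A ≠ ⊤ := lintegral_rpow_enorm_ne_top hχc hcχ hp
  have hB₁top : B₁ ≠ ⊤ := by
    simpa only [ENNReal.rpow_ofNat] using
      lintegral_rpow_enorm_ne_top (μ := volume) hχc hcχ (two_pos (α := ℝ))
  have hB₂top : B₂ ≠ ⊤ := by
    simpa only [ENNReal.rpow_ofNat] using
      lintegral_rpow_enorm_ne_top (μ := volume) hχ' (hcχ.fderiv ℝ) (two_pos (α := ℝ))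
  obtain ⟨D, hD⟩ : ∃ D : NNReal, (D : ℝ≥0∞) = K * (2 * (B₁ + B₂)) / A :=
    ⟨_, ENNReal.coe_toNNReal (by finiteness)⟩
  refine ⟨D, fun v hv hcv S hS => ?_⟩
  have hvc : Continuous v := hv.continuous
  have hv' : Continuous (fderiv ℝ v) := hv.continuous_fderiv one_ne_zero
  set V := ∫⁻ y, ‖v y‖ₑ ^ 2
  set W := ∫⁻ y, ‖fderiv ℝ v y‖ₑ ^ 2
  have average : A * ∫⁻ y, ‖v y‖ₑ ^ p ≤ K * S ^ r * (2 * (B₁ * W + B₂ * V)) := by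
    have hm : Measurable fun z : EuclideanSpace ℝ (Fin n) × EuclideanSpace ℝ (Fin n) =>
      ‖χ (z.2 - z.1)‖ₑ ^ 2 * ‖fderiv ℝ v z.2‖ₑ ^ 2 := by fun_prop
    have hm' : Measurable fun z : EuclideanSpace ℝ (Fin n) × EuclideanSpace ℝ (Fin n) =>
      ‖χ (z.2 - z.1)‖ₑ ^ 2 * ‖fderiv ℝ v z.2‖ₑ ^ 2
        + ‖fderiv ℝ χ (z.2 - z.1)‖ₑ ^ 2 * ‖v z.2‖ₑ ^ 2 := by fun_prop
    calc A * ∫⁻ y, ‖v y‖ₑ ^ p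
        = ∫⁻ x, ∫⁻ y, ‖χ (y - x)‖ₑ ^ p * ‖v y‖ₑ ^ p :=
          (lintegral_lintegral_sub_mul volume (f := fun y => ‖χ y‖ₑ ^ p)
            (g := fun y => ‖v y‖ₑ ^ p) (by fun_prop) (by fun_prop)).symm
      _ ≤ ∫⁻ x, K * S ^ r * (2 * ∫⁻ y, (‖χ (y - x)‖ₑ ^ 2 * ‖fderiv ℝ v y‖ₑ ^ 2
            + ‖fderiv ℝ χ (y - x)‖ₑ ^ 2 * ‖v y‖ₑ ^ 2)) :=
          lintegral_mono fun x => lintegral_cutoff_rpow_le hp.le hr hK hχ hv hcv x (hS x)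
      _ = K * S ^ r * (2 * ∫⁻ x, ∫⁻ y, (‖χ (y - x)‖ₑ ^ 2 * ‖fderiv ℝ v y‖ₑ ^ 2
            + ‖fderiv ℝ χ (y - x)‖ₑ ^ 2 * ‖v y‖ₑ ^ 2)) := by
          rw [lintegral_const_mul _ (hm'.lintegral_prod_right'.const_mul _),
            lintegral_const_mul _ hm'.lintegral_prod_right']
      _ = K * S ^ r * (2 * ((∫⁻ x, ∫⁻ y, ‖χ (y - x)‖ₑ ^ 2 * ‖fderiv ℝ v y‖ₑ ^ 2)
            + ∫⁻ x, ∫⁻ y, ‖fderiv ℝ χ (y - x)‖ₑ ^ 2 * ‖v y‖ₑ ^ 2)) := by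
          rw [← lintegral_add_left hm.lintegral_prod_right']
          congr 3 with x
          exact lintegral_add_left (by fun_prop) _
      _ = K * S ^ r * (2 * (B₁ * W + B₂ * V)) := by
          rw [lintegral_lintegral_sub_mul volume (f := fun y => ‖χ y‖ₑ ^ 2)
              (g := fun y => ‖fderiv ℝ v y‖ₑ ^ 2) (by fun_prop) (by fun_prop),
            lintegral_lintegral_sub_mul volume (f := fun y => ‖fderiv ℝ χ y‖ₑ ^ 2)
              (g := fun y => ‖v y‖ₑ ^ 2) (by fun_prop) (by fun_prop)]
  calc ∫⁻ y, ‖v y‖ₑ ^ p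
      ≤ K * S ^ r * (2 * (B₁ * W + B₂ * V)) / A := by
        rwa [ENNReal.le_div_iff_mul_le (.inl hA0) (.inl hAtop), mul_comm]
    _ ≤ K * S ^ r * (2 * ((B₁ + B₂) * (V + W))) / A := by
        gcongr
        rw [add_mul]
        gcongr
        exacts [le_add_self, le_self_add]
    _ = D * (V + W) * S ^ r := by
        simp only [hD, ENNReal.div_eq_inv_mul]
        ring

theorem measurableSet_unitCube {n : ℕ} (x : EuclideanSpace ℝ (Fin n)) :
    MeasurableSet (unitCube x) :=
  MeasurableSet.congr (MeasurableSet.iInter fun i : Fin n =>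
    measurableSet_le (f := fun y : EuclideanSpace ℝ (Fin n) => |y i - x i|)
      (g := fun _ => (1 / 2 : ℝ)) (by fun_prop) (by fun_prop)) (by ext; simp [unitCube])

/-- Gagliardo–Nirenberg with uniform local control: for `n ≥ 3`, `Ω ⊆ ℝⁿ` open and
`v ∈ H¹₀(Ω)` (here a smooth compactly supported function with support in `Ω`):
`‖v‖_{L^{2+4/n}(Ω)}^{2+4/n} ≲ ‖v‖_{H¹(Ω)}² · sup_x ‖v‖_{L²(Q₁(x) ∩ Ω)}^{4/n}`,
with a constant depending only on `n`. -/
theorem stmt_17 (n : ℕ) (hn : 3 ≤ n) :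
    ∃ C > (0 : ℝ), ∀ (Ω : Set (EuclideanSpace ℝ (Fin n))), IsOpen Ω →
      ∀ (v : EuclideanSpace ℝ (Fin n) → ℂ), ContDiff ℝ (⊤ : ℕ∞) v → HasCompactSupport v →
        tsupport v ⊆ Ω →
        (∫⁻ x in Ω, (‖v x‖₊ : ℝ≥0∞) ^ ((2 : ℝ) + 4 / n))
          ≤ ENNReal.ofReal C *
            ((∫⁻ x in Ω, (‖v x‖₊ : ℝ≥0∞) ^ 2)
              + ∫⁻ x in Ω, (‖fderiv ℝ v x‖₊ : ℝ≥0∞) ^ 2) *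
            (⨆ x : EuclideanSpace ℝ (Fin n),
              ∫⁻ y in unitCube x ∩ Ω, (‖v y‖₊ : ℝ≥0∞) ^ 2) ^ ((2 : ℝ) / n) := by
  obtain ⟨χ, hχ, hcχ, hχ0, hχ1, hχ_cube⟩ := exists_contDiff_cutoff_unitCube n
  obtain ⟨D, hD⟩ := exists_lintegral_rpow_le_of_cutoff_mass_le hn hχ hcχ hχ0
  refine ⟨D + 1, by positivity, fun Ω hΩ v hv hcv hsupp => ?_⟩
  have hv1 : ContDiff ℝ 1 v := hv.of_le (by exact_mod_cast le_top)
  have hv0 : ∀ y, y ∉ Ω → v y = 0 := fun y hy =>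
    image_eq_zero_of_notMem_tsupport fun h => hy (hsupp h)
  have hv0' : ∀ y, y ∉ Ω → fderiv ℝ v y = 0 := fun y hy =>
    fderiv_of_notMem_tsupport ℝ fun h => hy (hsupp h)
  have extend : ∀ f : EuclideanSpace ℝ (Fin n) → ℝ≥0∞, (∀ y, y ∉ Ω → f y = 0) →
      ∫⁻ y in Ω, f y = ∫⁻ y, f y := fun f hf => by
    rw [← lintegral_indicator hΩ.measurableSet, Set.indicator_eq_self.2]
    exact fun y hy => by_contra fun h => hy (hf y h)
  simp only [← enorm_eq_nnnorm]
  rw [extend (fun y => ‖v y‖ₑ ^ 2) fun y hy => by simp [hv0 y hy],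
    extend (fun y => ‖fderiv ℝ v y‖ₑ ^ 2) fun y hy => by simp [hv0' y hy, enorm_eq_nnnorm]]
  set S := ⨆ x : EuclideanSpace ℝ (Fin n), ∫⁻ y in unitCube x ∩ Ω, ‖v y‖ₑ ^ 2
  have mass : ∀ x, ∫⁻ y, ‖χ (y - x) • v y‖ₑ ^ 2 ≤ S := fun x => by
    refine le_trans ?_ (le_iSup _ x)
    rw [← lintegral_indicator ((measurableSet_unitCube x).inter hΩ.measurableSet)]
    refine lintegral_mono fun y => ?_
    by_cases hy : y ∈ unitCube x ∩ Ω
    · rw [Set.indicator_of_mem hy, enorm_smul]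
      gcongr
      exact mul_le_of_le_one_left' (hχ1 _)
    · have : χ (y - x) • v y = 0 := by
        by_cases h : y ∈ unitCube x
        · rw [hv0 y fun h' => hy ⟨h, h'⟩, smul_zero]
        · rw [hχ_cube x y h, zero_smul]
      simp [this]
  refine (setLIntegral_le_lintegral _ _).trans ((hD v hv1 hcv S mass).trans ?_)
  gcongr
  rw [← ENNReal.ofReal_coe_nnreal]
  exact ENNReal.ofReal_le_ofReal (by simp)
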